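/- arXiv:1908.00972 — 2 statements merged into one kernel-verified Lean document; each statement's English description precedes it below -/
import Mathlib

section
/- Let K = ℂ(t) be the field of rational functions in one variable t over ℂ, and consider the polynomial p(X) = X⁵ + t·X + 1 with coefficients in K. Then the Galois group of p over K (the automorphism group of its splitting field over K) is isomorphic to the symmetric group S₅ on five elements; in particular it is a group of order 120 and is not solvable. -/
open Polynomial

theorem aux_galActionHom {K F : Type*} [Field K] [Field F] [Algebra K F] [CharZero K]
    (p : K[X]) (hirr : Irreducible p) (hdeg : p.natDegree = 5)
    (h3 : 3 ≤ (p.rootSet F).ncard) (hns : ¬ (p.map (algebraMap K F)).Splits) :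
    Nonempty (p.Gal ≃* Equiv.Perm (Fin 5)) := by
  classical
  let q := p.map (algebraMap K F)
  let L := q.SplittingField
  have : CharZero F := charZero_of_injective_algebraMap (algebraMap K F).injective
  have hsepq : q.Separable := hirr.separable.map
  have : IsGalois F L := IsGalois.of_separable_splitting_field hsepq
  have hspl : (q.map (algebraMap F L)).Splits := SplittingField.splits q
  have hmap : p.map (algebraMap K L) = q.map (algebraMap F L) := by
    rw [Polynomial.map_map, ← IsScalarTower.algebraMap_eq]
  have hsplL : (p.map (algebraMap K L)).Splits := by rw [hmap]; exact hspl
  have : Fact ((p.map (algebraMap K L)).Splits) := ⟨hsplL⟩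
  have h1 : Fintype.card (p.rootSet L) = 5 := by
    rw [← hdeg]; exact card_rootSet_eq_natDegree hirr.separable hsplL
  have hσ : ∃ α ∈ p.rootSet L, ∃ σ : L ≃ₐ[F] L, σ α ≠ α := by
    by_contra! hcon
    apply hns
    refine Splits.of_splits_map_of_injective (algebraMap F L).injective hspl ?_
    intro α hα
    have := (IsGalois.mem_range_algebraMap_iff_fixed (F := F) α).2 (hcon α ?_)
    · exact this
    · rw [mem_rootSet']
      rw [← hmap] at hα
      have := mem_roots'.1 hα
      exact ⟨this.1, by rw [aeval_def, ← eval_map]; exact this.2⟩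
  obtain ⟨α, hα, σ, hσα⟩ := hσ
  let g := Gal.restrict p L (σ.restrictScalars K)
  have hg : ∀ x : p.rootSet L, ((Gal.galActionHom p L g x : p.rootSet L) : L) = σ x := fun x =>
    Gal.galActionHom_restrict p L (σ.restrictScalars K) x
  have hp0 : p.map (algebraMap K L) ≠ 0 := Polynomial.map_ne_zero hirr.ne_zero
  have hswap : (Gal.galActionHom p L g).IsSwap := by
    rw [← Equiv.Perm.card_support_eq_two]
    apply le_antisymm
    · let f : p.rootSet F → p.rootSet L := fun x => ⟨algebraMap F L x, by
        rw [mem_rootSet']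
        refine ⟨hp0, ?_⟩
        rw [aeval_algebraMap_apply, (mem_rootSet'.1 x.2).2, map_zero]⟩
      have hf : Function.Injective f := fun x y hxy =>
        Subtype.ext ((algebraMap F L).injective (congrArg Subtype.val hxy))
      have hc : 3 ≤ (Gal.galActionHom p L g).supportᶜ.card := by
        have e1 : 3 ≤ (Finset.univ.image f).card := by
          rw [Finset.card_image_of_injective _ hf, Finset.card_univ]
          rwa [← Nat.card_eq_fintype_card, Nat.card_coe_set_eq]
        refine e1.trans (Finset.card_le_card ?_)
        intro y hy
        obtain ⟨x, -, rfl⟩ := Finset.mem_image.1 hy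
        simp only [Finset.mem_compl, Equiv.Perm.mem_support, not_not]
        apply Subtype.ext
        rw [hg]
        exact σ.commutes _
      have := Finset.card_compl_add_card (Gal.galActionHom p L g).support
      omega
    · apply Equiv.Perm.two_le_card_support_of_ne_one
      intro h
      apply hσα
      have := hg ⟨α, hα⟩
      rw [h] at this
      exact this.symm
  have hbij : Function.Bijective (Gal.galActionHom p L) := by
    refine ⟨Gal.galActionHom_injective p L, MonoidHom.range_eq_top.1 ?_⟩
    have h5 : (5 : ℕ).Prime := by norm_num
    refine Equiv.Perm.subgroup_eq_top_of_swap_mem (H := (Gal.galActionHom p L).range)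
      (τ := Gal.galActionHom p L g) (by rwa [h1]) ?_ ⟨g, rfl⟩ hswap
    rw [h1, ← hdeg]
    simpa only [Fintype.card_eq_nat_card,
      Nat.card_congr (MonoidHom.ofInjective (Gal.galActionHom_injective p L)).toEquiv.symm]
      using Gal.prime_degree_dvd_card hirr (by rwa [hdeg])
  exact ⟨(MulEquiv.ofBijective _ hbij).trans
    (Equiv.permCongrHom (Fintype.equivFinOfCardEq h1))⟩

theorem aux_irreducible :
    Irreducible (X ^ 5 + C RatFunc.X * X + 1 : Polynomial (RatFunc ℂ)) := by
  let P : ℂ[X][X] := X ^ 5 + C X * X + 1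
  have hP : P.Monic := by
    have : P = X ^ (4+1) + (C X * X + 1) := by simp only [P]; ring
    rw [this]
    refine monic_X_pow_add ?_
    compute_degree!
  have hm : (X ^ 5 + C RatFunc.X * X + 1 : Polynomial (RatFunc ℂ)) =
      P.map (algebraMap ℂ[X] (RatFunc ℂ)) := by
    simp [P]
  rw [hm, ← hP.irreducible_iff_irreducible_map_fraction_map]
  have hs : P = Bivariate.swap (R := ℂ) (C X * X + C (X ^ 5 + 1)) := by
    simp [P, Bivariate.swap_apply]; ring
  rw [hs, MulEquiv.irreducible_iff]
  refine irreducible_C_mul_X_add_C X_ne_zero (IsCoprime.isRelPrime ⟨-X ^ 4, 1, by ring⟩)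

theorem aux_param : ∃ a : ℂ, 4 * a ^ 5 = 1 ∧ a ≠ 0 := by
  obtain ⟨a, ha⟩ := IsAlgClosed.exists_pow_nat_eq (1/4 : ℂ) (n := 5) (by norm_num)
  refine ⟨a, by rw [ha]; norm_num, ?_⟩
  rintro rfl
  norm_num at ha

theorem aux_cubic (a : ℂ) (ha : 4 * a ^ 5 = 1) :
    ∃ s : Finset ℂ, s.card = 3 ∧
      ∀ b ∈ s, b ^ 5 + (-5 * a ^ 4) * b + 1 = 0 ∧ 5 * b ^ 4 + (-5 * a ^ 4) ≠ 0 := by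
  classical
  have ha0 : a ≠ 0 := by rintro rfl; norm_num at ha
  let c : ℂ[X] := X ^ 3 + C (2 * a) * X ^ 2 + C (3 * a ^ 2) * X + C (4 * a ^ 3)
  have hdeg : c.natDegree = 3 := by simp only [c]; compute_degree!
  have hd : derivative c = 3 * X ^ 2 + 4 * C a * X + 3 * C a ^ 2 := by
    simp only [c, derivative_add, derivative_mul, derivative_C, derivative_X_pow, derivative_X]
    simp only [C_mul, C_pow, Nat.cast_ofNat, map_ofNat C]
    ring
  have hsep : c.Separable := by
    refine ⟨C (a / 5) * (5 * C a - 3 * X), C (a / 5) * (X ^ 2 - C a * X), ?_⟩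
    rw [hd]
    have h20 : C (a / 5) * (20 * C a ^ 4) = (1 : ℂ[X]) := by
      have : (20 : ℂ[X]) = C 20 := (map_ofNat C 20).symm
      rw [this, ← C_pow, ← C_mul, ← C_mul, ← C_1]
      congr 1
      linear_combination ha
    rw [← h20]
    simp only [c, C_mul, C_pow]
    have e2 : (C 2 : ℂ[X]) = 2 := map_ofNat C 2
    have e3 : (C 3 : ℂ[X]) = 3 := map_ofNat C 3
    have e4 : (C 4 : ℂ[X]) = 4 := map_ofNat C 4
    rw [e2, e3, e4]
    ring
  have hcard := card_rootSet_eq_natDegree (K := ℂ) hsep (IsAlgClosed.splits _)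
  refine ⟨(c.rootSet ℂ).toFinset, ?_, ?_⟩
  · rw [Set.toFinset_card, hcard, hdeg]
  · intro b hb
    have hb' : b ^ 3 + 2 * a * b ^ 2 + 3 * a ^ 2 * b + 4 * a ^ 3 = 0 := by
      have := (mem_rootSet'.1 (Set.mem_toFinset.1 hb)).2
      simpa [c] using this
    refine ⟨by linear_combination (b - a) ^ 2 * hb' - ha, fun h => ?_⟩
    have h1 : (b - a) * (20 * a ^ 4) = 0 := by
      linear_combination b * h + ((b-a) * (5 * a - 3 * b) - 2 * b * (b - a)) * hb'
    have h2 : b = a := by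
      rcases mul_eq_zero.1 h1 with h | h
      · exact sub_eq_zero.1 h
      · exfalso; simp [ha0] at h
    subst h2
    have : 10 * b ^ 3 = 0 := by linear_combination hb'
    simp [ha0] at this

theorem aux_noroot (a : ℂ) (ha : 4 * a ^ 5 = 1) (r : PowerSeries ℂ)
    (hr : r ^ 5 + (PowerSeries.C (-5 * a ^ 4) + PowerSeries.X) * r + 1 = 0) :
    PowerSeries.constantCoeff r ≠ a := by
  intro h
  have ha0 : a ≠ 0 := by rintro rfl; norm_num at ha
  have : PowerSeries.X ∣ r - PowerSeries.C a := by
    rw [PowerSeries.X_dvd_iff]; simp [h]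
  obtain ⟨u, hu⟩ := this
  obtain rfl : r = PowerSeries.C a + PowerSeries.X * u := by rw [← hu]; ring
  have hA : 4 * (PowerSeries.C a : PowerSeries ℂ) ^ 5 = 1 := by
    have : (4 : PowerSeries ℂ) = PowerSeries.C 4 := (map_ofNat PowerSeries.C 4).symm
    rw [this, ← map_pow, ← map_mul, ha, map_one]
  have h5 : (PowerSeries.C (-5 * a ^ 4) : PowerSeries ℂ) = -5 * PowerSeries.C a ^ 4 := by
    rw [map_mul, map_neg, map_pow, map_ofNat]
  rw [h5] at hr
  generalize hAd : (PowerSeries.C a : PowerSeries ℂ) = A at *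
  have key : PowerSeries.X * (A + PowerSeries.X * (10 * A ^ 3 * u ^ 2 +
      10 * A ^ 2 * PowerSeries.X * u ^ 3 + 5 * A * PowerSeries.X ^ 2 * u ^ 4 +
      PowerSeries.X ^ 3 * u ^ 5 + u)) = 0 := by
    linear_combination hr + hA
  have h2 := (mul_eq_zero.1 key).resolve_left PowerSeries.X_ne_zero
  have h3 := congrArg PowerSeries.constantCoeff h2
  rw [← hAd] at h3
  simp at h3
  exact ha0 h3

theorem aux_hensel (a b : ℂ) (hb : b ^ 5 + (-5 * a ^ 4) * b + 1 = 0)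
    (hb' : 5 * b ^ 4 + (-5 * a ^ 4) ≠ 0) :
    ∃ r : PowerSeries ℂ, r ^ 5 + (PowerSeries.C (-5 * a ^ 4) + PowerSeries.X) * r + 1 = 0 ∧
      PowerSeries.constantCoeff r = b := by
  let I : Ideal (PowerSeries ℂ) := Ideal.span {PowerSeries.X}
  have hI : ∀ x : PowerSeries ℂ, x ∈ I ↔ PowerSeries.constantCoeff x = 0 := fun x => by
    rw [Ideal.mem_span_singleton, PowerSeries.X_dvd_iff]
  let f : (PowerSeries ℂ)[X] := X ^ (4+1) +
    (C (PowerSeries.C (-5 * a ^ 4) + PowerSeries.X) * X + 1)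
  have hf : f.Monic := by
    refine monic_X_pow_add ?_
    compute_degree!
  obtain ⟨r, hr, hr'⟩ := HenselianRing.is_henselian (I := I) f hf (PowerSeries.C b) (by
      rw [hI]; simp [f]; linear_combination hb) (by
      apply IsUnit.map
      rw [PowerSeries.isUnit_iff_constantCoeff]
      refine IsUnit.mk0 _ ?_
      intro h
      apply hb'
      simp only [f, derivative_add, derivative_mul, derivative_C, derivative_X_pow, derivative_X,
        derivative_one] at h
      simp only [eval_add, eval_mul, eval_C, eval_pow, eval_X, eval_one, eval_zero, map_add,
        map_mul, map_pow, map_one, map_zero, PowerSeries.constantCoeff_C,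
        PowerSeries.constantCoeff_X, Nat.cast_ofNat, eval_natCast, map_natCast] at h
      push_cast at h
      linear_combination h)
  refine ⟨r, ?_, ?_⟩
  · simp [f, IsRoot] at hr
    simp
    linear_combination hr
  · rw [hI] at hr'
    simpa [sub_eq_zero] using hr'

theorem aux_main {F : Type*} [Field F] [Algebra (PowerSeries ℂ) F]
    [IsFractionRing (PowerSeries ℂ) F] :
    Nonempty ((X ^ 5 + C RatFunc.X * X + 1 : Polynomial (RatFunc ℂ)).Gal ≃*
      Equiv.Perm (Fin 5)) := by
  classical
  obtain ⟨a, ha, ha0⟩ := aux_param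
  let T : PowerSeries ℂ := PowerSeries.C (-5 * a ^ 4) + PowerSeries.X
  let φ₀ : ℂ[X] →+* PowerSeries ℂ :=
    (Polynomial.coeToPowerSeries.ringHom).comp (taylorAlgHom (-5 * a ^ 4)).toRingHom
  let φ : ℂ[X] →+* F := (algebraMap (PowerSeries ℂ) F).comp φ₀
  have hinj : Function.Injective φ := by
    refine (IsFractionRing.injective (PowerSeries ℂ) F).comp ?_
    exact (Polynomial.coe_injective ℂ).comp (taylor_injective _)
  have hφX : φ X = algebraMap _ F T := by
    simp only [φ, φ₀, RingHom.comp_apply]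
    congr 1
    simp [T, taylor_X, add_comm]
  have hle : nonZeroDivisors ℂ[X] ≤ (nonZeroDivisors F).comap φ :=
    nonZeroDivisors_le_comap_nonZeroDivisors_of_injective φ hinj
  let _ : Algebra (RatFunc ℂ) F := (RatFunc.liftRingHom φ hle).toAlgebra
  have hX : algebraMap (RatFunc ℂ) F RatFunc.X = algebraMap _ F T := by
    rw [← hφX, ← RatFunc.algebraMap_X]
    exact RatFunc.liftRingHom_algebraMap φ hle X
  set p : Polynomial (RatFunc ℂ) := X ^ 5 + C RatFunc.X * X + 1 with hp
  let P : (PowerSeries ℂ)[X] := X ^ 5 + C T * X + 1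
  have hpP : p.map (algebraMap (RatFunc ℂ) F) = P.map (algebraMap _ F) := by
    simp [p, P, hX]
  have hP : P.Monic := by
    have : P = X ^ (4+1) + (C T * X + 1) := by simp only [P]; ring
    rw [this]
    refine monic_X_pow_add ?_
    compute_degree!
  have hPe : ∀ r, P.eval r = r ^ 5 + T * r + 1 := fun r => by simp [P]
  refine aux_galActionHom (F := F) p aux_irreducible (by simp only [p]; compute_degree!) ?_ ?_
  · obtain ⟨s, hs, hs'⟩ := aux_cubic a ha
    choose! r hr hr' using fun b (hb : b ∈ s) => aux_hensel a b (hs' b hb).1 (hs' b hb).2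
    have hsub : ((s.image fun b => algebraMap (PowerSeries ℂ) F (r b) : Finset F) : Set F) ⊆
        p.rootSet F := by
      intro y hy
      simp only [Finset.coe_image, Set.mem_image, Finset.mem_coe] at hy
      obtain ⟨b, hb, rfl⟩ := hy
      rw [mem_rootSet']
      refine ⟨Polynomial.map_ne_zero aux_irreducible.ne_zero, ?_⟩
      rw [aeval_def, ← eval_map, hpP, eval_map, eval₂_at_apply, hPe, hr b hb, map_zero]
    rw [← hs, ← Finset.card_image_of_injOn (f := fun b => algebraMap (PowerSeries ℂ) F (r b)) (s := s),
      ← Set.ncard_coe_finset]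
    · exact Set.ncard_le_ncard hsub (Set.toFinite _)
    · intro b hb b' hb' h
      have := IsFractionRing.injective (PowerSeries ℂ) F h
      rw [← hr' b hb, ← hr' b' hb', this]
  · intro hsp
    rw [hpP] at hsp
    have hlift : P.Splits := by
      refine Splits.of_splits_map_of_injective
        (IsFractionRing.injective (PowerSeries ℂ) F) hsp ?_
      intro x hx
      have hint : IsIntegral (PowerSeries ℂ) x := by
        refine ⟨P, hP, ?_⟩
        rw [← eval_map]
        exact (mem_roots'.1 hx).2
      exact IsIntegrallyClosed.isIntegral_iff.1 hint
    have hev := hlift.eval_eq_prod_roots_of_monic hP (PowerSeries.C a)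
    have h0 := congrArg PowerSeries.constantCoeff hev
    rw [hPe, map_multiset_prod] at h0
    have hz : PowerSeries.constantCoeff
        ((PowerSeries.C a : PowerSeries ℂ) ^ 5 + T * PowerSeries.C a + 1) = 0 := by
      simp [T]
      linear_combination -ha
    rw [hz] at h0
    have := Multiset.prod_eq_zero_iff.1 h0.symm
    simp only [Multiset.map_map, Multiset.mem_map, Function.comp_apply] at this
    obtain ⟨r, hr, hr0⟩ := this
    refine aux_noroot a ha r ?_ ?_
    · rw [← hPe r]
      exact (mem_roots'.1 hr).2
    · simp at hr0
      exact (sub_eq_zero.1 hr0).symm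

theorem gal_quintic_X_pow_five_add_tX_add_one :
    let p : Polynomial (RatFunc ℂ) := X ^ 5 + C RatFunc.X * X + 1
    Nonempty (p.Gal ≃* Equiv.Perm (Fin 5)) ∧
    Nat.card p.Gal = 120 ∧ ¬ IsSolvable p.Gal := by
  intro p
  obtain ⟨e⟩ : Nonempty (p.Gal ≃* Equiv.Perm (Fin 5)) :=
    aux_main (F := FractionRing (PowerSeries ℂ))
  refine ⟨⟨e⟩, ?_, ?_⟩
  · rw [Nat.card_congr e.toEquiv, Nat.card_eq_fintype_card, Fintype.card_perm, Fintype.card_fin]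
    rfl
  · intro h
    have h' : Group.IsSolvable p.Gal := h
    exact Equiv.Perm.not_isSolvable_fin_5
      (Group.isSolvable_of_surjective (f := e.toMonoidHom) e.surjective)
end

section
/- Let K = ℂ(t) be the field of rational functions in one variable t over ℂ, and consider the polynomial q(X) = 3X⁵ − 25X³ + 60X − t with coefficients in K. Then the Galois group of q over K is not solvable. -/
open Polynomial

noncomputable def arnF : ℂ[X][X] := 3 * X ^ 5 - 25 * X ^ 3 + 60 * X - C X

lemma arnF_natDegree : arnF.natDegree = 5 := by unfold arnF; compute_degree!

lemma arnF_irr : Irreducible arnF := by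
  have h : arnF = Bivariate.swap (R := ℂ) (C (3 * X ^ 5 - 25 * X ^ 3 + 60 * X) - X) := by
    simp [arnF, Bivariate.swap_apply, aevalAeval, aevalAevalEquiv]
  rw [h, MulEquiv.irreducible_iff]
  have := irreducible_X_sub_C (3 * X ^ 5 - 25 * X ^ 3 + 60 * X : ℂ[X])
  refine (Associated.irreducible_iff ?_).mp this
  exact ⟨-1, by simp⟩

lemma arnF_map_irr (K : Type*) [Field K] [Algebra ℂ[X] K] [IsFractionRing ℂ[X] K] :
    Irreducible (arnF.map (algebraMap ℂ[X] K)) := by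
  rw [← IsPrimitive.irreducible_iff_irreducible_map_fraction_map]
  · exact arnF_irr
  · exact arnF_irr.isPrimitive (by simp [arnF_natDegree])

lemma not_solv (K L : Type*) [Field K] [CharZero K] [Field L] [Algebra K L] (q : K[X]) (hq : Irreducible q)
   (hd : q.natDegree = 5) [hs : q.IsSplittingField K L] (g : Gal(L/K)) (x y : L) (hxy : x ≠ y)
   (hx : x ∈ q.rootSet L) (hgx : g x = y) (hgy : g y = x) (h : ∀ z ∈ q.rootSet L, z ≠ x → z ≠ y → g z = z) :
   ¬ Group.IsSolvable q.Gal := by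
  intro hsol
  classical
  have hq0 : q ≠ 0 := hq.ne_zero
  have : Fact ((q.map (algebraMap K L)).Splits) := ⟨hs.splits⟩
  have hy : y ∈ q.rootSet L := by
    rw [mem_rootSet] at hx ⊢
    refine ⟨hx.1, ?_⟩
    rw [← hgx, aeval_algEquiv, AlgHom.comp_apply, hx.2]; simp
  have := Gal.galAction_isPretransitive q L hq
  have hcard : Nat.card (q.rootSet L) = 5 := by
    rw [Nat.card_eq_fintype_card, card_rootSet_eq_natDegree hq.separable hs.splits, hd]
  have hprim : MulAction.IsPreprimitive q.Gal (q.rootSet L) :=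
    MulAction.IsPreprimitive.of_prime_card (by rw [hcard]; norm_num)
  let φ := Gal.galActionHom q L
  have hp2 : MulAction.IsPreprimitive φ.range (q.rootSet L) := by
    let f : q.rootSet L →ₑ[φ.rangeRestrict] q.rootSet L := ⟨id, fun _ _ => rfl⟩
    exact MulAction.IsPreprimitive.of_surjective (f := f) Function.surjective_id
  have htop := Equiv.Perm.subgroup_eq_top_of_isPreprimitive_of_isSwap_mem hp2
    (φ (Gal.restrict q L g)) ?_ ⟨_, rfl⟩
  · have hsurj : Function.Surjective φ := MonoidHom.range_eq_top.mp htop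
    have := Group.isSolvable_of_surjective hsurj
    refine Equiv.Perm.not_isSolvable _ ?_ this
    rw [← Nat.cast_card, hcard]; norm_num
  · refine ⟨⟨x, hx⟩, ⟨y, hy⟩, by simpa using hxy, ?_⟩
    ext ⟨z, hz⟩
    rw [Gal.galActionHom_restrict]
    by_cases h1 : z = x
    · subst h1; simp [hgx]
    by_cases h2 : z = y
    · subst h2; simp [hgy]
    rw [Equiv.swap_apply_of_ne_of_ne (by simpa using h1) (by simpa using h2)]
    exact h z hz h1 h2

noncomputable def arnH : ℂ[X] := 3 * X ^ 4 + 3 * X ^ 3 - 22 * X ^ 2 - 22 * X + 38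

lemma arnH_sep : arnH.Separable := by
  refine ⟨C (1/846450) * (9427 - 21714 * X - 1608 * X ^ 2),
    C (1/846450) * (-22192 - 2549 * X + 5529 * X ^ 2 + 402 * X ^ 3), ?_⟩
  have h : (C (1/846450) : ℂ[X]) * 846450 = 1 := by
    rw [← C_ofNat, ← C_mul]; norm_num
  have hd : derivative arnH = 12 * X ^ 3 + 9 * X ^ 2 - 44 * X - 22 := by
    have h3 : (C 3 : ℂ[X]) = 3 := rfl
    have h2 : (C 2 : ℂ[X]) = 2 := rfl
    simp [arnH]; ring_nf; simp [h3, h2]; ring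
  rw [hd, arnH]
  linear_combination h

lemma arnH_card : (arnH.rootSet ℂ).ncard = 4 := by
  classical
  have hd : arnH.natDegree = 4 := by unfold arnH; compute_degree!
  rw [← Nat.card_coe_set_eq, Nat.card_eq_fintype_card,
    card_rootSet_eq_natDegree arnH_sep (IsAlgClosed.splits _), hd]

lemma arnF_integral (L : Type*) [Field L] [Algebra ℂ[X] L] (x : L) (hx : aeval x arnF = 0) :
    IsIntegral ℂ[X] x := by
  have h3 : (C (1/3) : ℂ[X]) * 3 = 1 := by
    rw [← C_ofNat, ← C_mul]; norm_num
  refine ⟨C (C (1/3)) * arnF, ?_, ?_⟩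
  · have : arnF.leadingCoeff = 3 := by
      rw [leadingCoeff, arnF_natDegree]; simp [arnF, coeff_X, coeff_ofNat_mul]
    rw [Monic, leadingCoeff_mul, this, leadingCoeff_C, h3]
  · rw [← aeval_def, map_mul, hx, mul_zero]

lemma arn_swap (K L S : Type*) [Field K] [Field L] [CommRing S] [Algebra ℂ[X] K] [IsFractionRing ℂ[X] K]
    [Algebra K L] [Algebra ℂ[X] L] [IsScalarTower ℂ[X] K L] [Algebra ℂ[X] S] [Algebra S L]
    [IsScalarTower ℂ[X] S L] [IsIntegralClosure S ℂ[X] L] [CharZero K]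
    [hs : (arnF.map (algebraMap ℂ[X] K)).IsSplittingField K L] :
    ∃ (g : Gal(L/K)) (x y : L), x ≠ y ∧ aeval x arnF = 0 ∧ g x = y ∧ g y = x ∧
      ∀ z, aeval z arnF = 0 → z ≠ x → z ≠ y → g z = z := by
  classical
  have hirr := arnF_map_irr K
  have hq0 : arnF ≠ 0 := arnF_irr.ne_zero
  have : FiniteDimensional K L := IsSplittingField.finiteDimensional L (arnF.map (algebraMap ℂ[X] K))
  have : IsGalois K L := IsGalois.of_separable_splitting_field hirr.separable
  have := (IsIntegralClosure.algebraMap_injective S ℂ[X] L).isDomain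
  have := IsIntegralClosure.isDedekindDomain ℂ[X] K L S
  have := IsIntegralClosure.isFractionRing_of_finite_extension ℂ[X] K L S
  have := IsIntegralClosure.finite ℂ[X] K L S
  have : Algebra.IsIntegral ℂ[X] S := inferInstance
  have : FaithfulSMul ℂ[X] L := by
    rw [faithfulSMul_iff_algebraMap_injective, IsScalarTower.algebraMap_eq ℂ[X] K L]
    exact (algebraMap K L).injective.comp (IsFractionRing.injective _ _)
  have hSL := IsIntegralClosure.algebraMap_injective S ℂ[X] L
  have : FaithfulSMul ℂ[X] S := by
    rw [faithfulSMul_iff_algebraMap_injective]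
    have := FaithfulSMul.algebraMap_injective ℂ[X] L
    rw [IsScalarTower.algebraMap_eq ℂ[X] S L] at this
    exact Function.Injective.of_comp this
  have : Module.IsTorsionFree ℂ[X] S := inferInstance
  have : Module.Flat ℂ[X] S := inferInstance
  let : MulSemiringAction Gal(L/K) S := IsIntegralClosure.MulSemiringAction ℂ[X] K L S
  have := IsGaloisGroup.of_isFractionRing Gal(L/K) ℂ[X] S K L
  have hact (g : Gal(L/K)) (s : S) : algebraMap S L (g • s) = g (algebraMap S L s) :=
    algebraMap_galRestrict_apply ℂ[X] g s
  -- splitting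
  have hsplL : (arnF.map (algebraMap ℂ[X] L)).Splits := by
    have := hs.splits
    rwa [Polynomial.map_map, ← IsScalarTower.algebraMap_eq] at this
  have hspl : (arnF.map (algebraMap ℂ[X] S)).Splits := by
    refine Splits.of_splits_map_of_injective (i := algebraMap S L) hSL ?_ ?_
    · rwa [Polynomial.map_map, ← IsScalarTower.algebraMap_eq]
    · intro a ha
      rw [Polynomial.map_map, ← IsScalarTower.algebraMap_eq] at ha
      have ha' : aeval a arnF = 0 := by
        have := isRoot_of_mem_roots ha
        rwa [IsRoot, eval_map_algebraMap] at this
      obtain ⟨y, hy⟩ := IsIntegralClosure.isIntegral_iff (A := S) |>.mp (arnF_integral L a ha')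
      exact ⟨y, hy⟩
  have hroot (s : S) : s ∈ arnF.rootSet S ↔ aeval (algebraMap S L s) arnF = 0 := by
    rw [mem_rootSet_of_injective (FaithfulSMul.algebraMap_injective _ _) hq0, aeval_algebraMap_apply,
      map_eq_zero_iff _ hSL]
  -- the prime
  let p : Ideal ℂ[X] := Ideal.span {X - C 38}
  have hpm : p.IsMaximal := PrincipalIdealRing.isMaximal_of_irreducible (irreducible_X_sub_C _)
  have hp0 : p ≠ ⊥ := by simp [p, X_sub_C_ne_zero]
  obtain ⟨P, hPm, hPp⟩ := Ideal.exists_maximal_ideal_liesOver_of_isIntegral (S := S) p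
  have htP : algebraMap ℂ[X] S (X - C 38) ∈ P := by
    have : X - C 38 ∈ p := Ideal.mem_span_singleton_self _
    rwa [hPp.over] at this
  have hperf : PerfectField p.ResidueField := by
    have : CharZero p.ResidueField := by
      exact charZero_of_injective_algebraMap (R := ℂ) (algebraMap ℂ p.ResidueField).injective
    infer_instance
  -- the residue field
  let ι : ℂ →+* S ⧸ P := (algebraMap ℂ[X] (S ⧸ P)).comp C
  have hι : Function.Injective ι := ι.injective
  have hX : algebraMap ℂ[X] (S ⧸ P) X = ι 38 := by
    have : algebraMap ℂ[X] (S ⧸ P) (X - C 38) = 0 := by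
      rw [IsScalarTower.algebraMap_apply ℂ[X] S (S ⧸ P)]
      exact Ideal.Quotient.eq_zero_iff_mem.mpr htP
    rwa [map_sub, sub_eq_zero] at this
  have hFP : arnF.map (algebraMap ℂ[X] (S ⧸ P)) ≠ 0 := by
    intro h0
    have h5 := congrArg (fun r => coeff r 5) h0
    have h3 : arnF.coeff 5 = C 3 := by simp [arnF, coeff_X, coeff_ofNat_mul]; rfl
    simp only [coeff_map, h3, coeff_zero] at h5
    have : ι 3 = 0 := h5
    rw [map_eq_zero_iff _ hι] at this
    norm_num at this
  have hrootP (z : ℂ) (hz : aeval z arnH = 0) : ι z ∈ arnF.rootSet (S ⧸ P) := by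
    rw [mem_rootSet']
    refine ⟨hFP, ?_⟩
    have h1 : aeval (ι z) arnF = ι (3 * z ^ 5 - 25 * z ^ 3 + 60 * z - 38) := by
      simp only [arnF, map_sub, map_add, map_mul, map_pow, map_ofNat, aeval_X, aeval_C, hX]
    have h2 : 3 * z ^ 5 - 25 * z ^ 3 + 60 * z - 38 = 0 := by
      simp [arnH] at hz
      linear_combination (z - 1) * hz
    rw [h1, h2, map_zero]
  have himg := hspl.image_rootSet_of_map_ne_zero (Ideal.Quotient.mkₐ ℂ[X] P) hFP
  have hle : p.map (algebraMap ℂ[X] S) ≤ P ^ 2 := by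
    have h1 := hrootP 1 (by simp [arnH]; norm_num)
    rw [← himg] at h1
    obtain ⟨x, hx, hx1⟩ := h1
    have hx1 : x - 1 ∈ P := by
      rw [← Ideal.Quotient.eq_zero_iff_mem, map_sub, sub_eq_zero, map_one]
      simpa using hx1
    rw [Ideal.map_span, Set.image_singleton, Ideal.span_singleton_le_iff_mem]
    have hx2 := ((mem_rootSet'.mp hx).2)
    have h38 : algebraMap ℂ[X] S (C 38) = 38 := map_ofNat ((algebraMap ℂ[X] S).comp C) 38
    have : algebraMap ℂ[X] S (X - C 38) = (3 * x ^ 3 + 6 * x ^ 2 - 16 * x - 38) * (x - 1) ^ 2 := by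
      simp only [arnF, map_sub, map_add, map_mul, map_pow, map_ofNat, aeval_X, aeval_C] at hx2
      rw [map_sub, h38]
      linear_combination -hx2
    rw [this]
    exact Ideal.mul_mem_left _ _ (Ideal.pow_mem_pow hx1 2)
  have hmap0 : p.map (algebraMap ℂ[X] S) ≠ ⊥ := Ideal.map_ne_bot_of_ne_bot hp0
  have hram : 2 ≤ P.ramificationIdx ℂ[X] := by
    rw [Ideal.IsDedekindDomain.ramificationIdx_eq_multiplicity p P hmap0]
    refine FiniteMultiplicity.le_multiplicity_of_pow_dvd ?_ (Ideal.dvd_iff_le.mpr hle)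
    refine FiniteMultiplicity.of_not_isUnit ?_ hmap0
    rw [Ideal.isUnit_iff]
    exact hPm.ne_top
  have hcard : Nat.card (P.inertia Gal(L/K)) = P.ramificationIdx ℂ[X] := by
    rw [Ideal.card_inertia_eq_ramificationIdxIn p P, Ideal.ramificationIdxIn_eq_ramificationIdx p P Gal(L/K)]
  have : Nontrivial (P.inertia Gal(L/K)) := by
    rw [← Finite.one_lt_card_iff_nontrivial]; omega
  obtain ⟨⟨g, hg⟩, hg1⟩ := exists_ne (1 : P.inertia Gal(L/K))
  replace hg1 : g ≠ 1 := by simpa [Subtype.ext_iff] using hg1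
  have hn : (arnF.rootSet S).ncard ≤ (arnF.rootSet (S ⧸ P)).ncard + 1 := by
    have h5 : (arnF.rootSet S).ncard ≤ 5 := by
      rw [rootSet, Set.ncard_coe_finset]
      refine (Multiset.toFinset_card_le _).trans ((card_roots' _).trans ?_)
      exact natDegree_map_le.trans arnF_natDegree.le
    have h4 : (ι '' arnH.rootSet ℂ).ncard ≤ (arnF.rootSet (S ⧸ P)).ncard := by
      refine Set.ncard_le_ncard ?_ (rootSet_finite _ _)
      rintro _ ⟨z, hz, rfl⟩
      exact hrootP z (mem_rootSet'.mp hz).2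
    rw [Set.ncard_image_of_injective _ hι, arnH_card] at h4
    omega
  have hlift (z : L) (hz : aeval z arnF = 0) : ∃ s ∈ arnF.rootSet S, algebraMap S L s = z := by
    obtain ⟨y, hy⟩ := (IsIntegralClosure.isIntegral_iff (A := S)).mp (arnF_integral L z hz)
    exact ⟨y, (hroot y).mpr (hy ▸ hz), hy⟩
  have hg2 := hspl.toPermHom_apply_eq_one_or_isSwap_of_ncard_le_of_mem_inertia P hn g hg
  have hval (s : arnF.rootSet S) : algebraMap S L (MulAction.toPermHom Gal(L/K) (arnF.rootSet S) g s : S)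
      = g (algebraMap S L s) := hact g s
  rcases hg2 with h1 | ⟨x, y, hxy, h⟩
  · refine absurd ?_ hg1
    have hz (z : L) (hz : aeval z arnF = 0) : g z = z := by
      obtain ⟨s, hs, rfl⟩ := hlift z hz
      have := hval ⟨s, hs⟩
      rw [h1] at this
      exact this.symm
    have hadj := hs.adjoin_rootSet
    have : (g : L →ₐ[K] L) = AlgHom.id K L := by
      refine AlgHom.ext_of_adjoin_eq_top hadj ?_
      intro z hz'
      have := (mem_rootSet'.mp hz').2
      rw [aeval_map_algebraMap] at this
      exact hz z this
    ext z
    exact DFunLike.congr_fun this z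
  · refine ⟨g, algebraMap S L x, algebraMap S L y, ?_, (hroot x).mp x.2, ?_, ?_, ?_⟩
    · exact fun h => hxy (Subtype.ext (hSL h))
    · rw [← hval, h, Equiv.swap_apply_left]
    · rw [← hval, h, Equiv.swap_apply_right]
    · intro z hz hzx hzy
      obtain ⟨s, hs, rfl⟩ := hlift z hz
      have := hval ⟨s, hs⟩
      rw [h, Equiv.swap_apply_of_ne_of_ne] at this
      · exact this.symm
      · rintro rfl; exact hzx rfl
      · rintro rfl; exact hzy rfl

theorem gal_arnold_quintic_not_solvable :
    let q : Polynomial (RatFunc ℂ) :=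
      3 * X ^ 5 - 25 * X ^ 3 + 60 * X - C RatFunc.X
    ¬ IsSolvable q.Gal := by
  intro q
  have hq : arnF.map (algebraMap ℂ[X] (RatFunc ℂ)) = q := by
    simp [arnF, q, RatFunc.algebraMap_X]
  have hirr : Irreducible q := hq ▸ arnF_map_irr (RatFunc ℂ)
  have hd : q.natDegree = 5 := by
    rw [← hq, natDegree_map_eq_of_injective (IsFractionRing.injective _ _), arnF_natDegree]
  have : CharZero (RatFunc ℂ) := charZero_of_injective_algebraMap (algebraMap ℂ (RatFunc ℂ)).injective
  have hspl : (arnF.map (algebraMap ℂ[X] (RatFunc ℂ))).IsSplittingField (RatFunc ℂ) q.SplittingField := by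
    rw [hq]; infer_instance
  obtain ⟨g, x, y, hxy, hx, hgx, hgy, h⟩ := arn_swap (RatFunc ℂ) q.SplittingField
    (integralClosure ℂ[X] q.SplittingField)
  have hmem (z : q.SplittingField) : z ∈ q.rootSet q.SplittingField ↔ aeval z arnF = 0 := by
    have h0 : aeval z q = aeval z arnF := by
      have := aeval_map_algebraMap (RatFunc ℂ) z arnF
      rwa [show arnF.map (algebraMap ℂ[X] (RatFunc ℂ)) = q from hq] at this
    rw [mem_rootSet, h0]
    exact and_iff_right hirr.ne_zero
  exact not_solv (RatFunc ℂ) q.SplittingField q hirr hd g x y hxy ((hmem x).mpr hx) hgx hgy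
    fun z hz => h z ((hmem z).mp hz)
end
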